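/- If E ⊂ ℝ² is a set of locally finite perimeter that is a cone outside the unit ball (i.e. its indicator agrees with the indicator of its radial extension for |x|>1) and E ∩ ∂B₁ is a single closed arc with endpoints a, b, then there exists a rectifiable curve γ contained in the topological boundary ∂E joining a to b. -/

import Mathlib

open MeasureTheory Metric Set

/-- `ℝ²` as a Euclidean space. -/
abbrev Euc2 := EuclideanSpace ℝ (Fin 2)

/-- The divergence of a vector field, as the trace of its Fréchet derivative. -/
noncomputable def divg (X : Euc2 → Euc2) (x : Euc2) : ℝ :=
  LinearMap.trace ℝ Euc2 (fderiv ℝ X x).toLinearMap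

/-- `E` is a set of locally finite perimeter: on every bounded open set, the distributional
divergence of compactly supported `C¹` vector fields bounded by `1` integrated over `E`
is bounded (De Giorgi's definition of locally bounded variation of the indicator). -/
def HasLocallyFinitePerimeter (E : Set Euc2) : Prop :=
  ∀ U : Set Euc2, IsOpen U → Bornology.IsBounded U →
    ∃ C : ℝ, ∀ X : Euc2 → Euc2, ContDiff ℝ 1 X → (∀ x, ‖X x‖ ≤ 1) →
      IsCompact (tsupport X) → tsupport X ⊆ U → (∫ x in E, divg X x) ≤ C

/-- The point of the unit circle at angle `t`. -/
noncomputable def circ (t : ℝ) : Euc2 :=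
  (EuclideanSpace.equiv (Fin 2) ℝ).symm ![Real.cos t, Real.sin t]


open Filter Topology

lemma divg_smul (φ : Euc2 → ℝ) (hφ : ContDiff ℝ 1 φ) (e x : Euc2) :
    divg (fun y => φ y • e) x = fderiv ℝ φ x e := by
  unfold divg
  have h1 : HasFDerivAt φ (fderiv ℝ φ x) x := (hφ.differentiable (by norm_num) x).hasFDerivAt
  rw [(h1.smul_const e).fderiv]
  have := LinearMap.trace_eq_contract_apply (R := ℝ) (M := Euc2)
    ((fderiv ℝ φ x).toLinearMap ⊗ₜ[ℝ] e)
  rw [contractLeft_apply] at this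
  convert this using 2
  · ext : 1
    simp [dualTensorHom_apply]
  · rfl

lemma shift_est (E : Set Euc2) (R C : ℝ) 
    (hC : ∀ X : Euc2 → Euc2, ContDiff ℝ 1 X → (∀ x, ‖X x‖ ≤ 1) →
      IsCompact (tsupport X) → tsupport X ⊆ ball 0 (R+3) → (∫ x in E, divg X x) ≤ C)
    (φ : Euc2 → ℝ) (hφ : ContDiff ℝ 1 φ) (hφ1 : ∀ x, |φ x| ≤ 1)
    (hsupp : ∀ x, R + 1 < ‖x‖ → φ x = 0) (h : Euc2) (hh : ‖h‖ ≤ 1) :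
    (∫ x in E, φ (x - h)) - (∫ x in E, φ x) ≤ C * ‖h‖ := by
  by_cases h0 : h = 0
  · simp [h0]
  have hpos : 0 < ‖h‖ := norm_pos_iff.2 h0
  have hdiff : Differentiable ℝ φ := hφ.differentiable (by norm_num)
  have hcont : Continuous (fderiv ℝ φ) := hφ.continuous_fderiv (by norm_num)
  have hcs : HasCompactSupport φ := by
    apply HasCompactSupport.of_support_subset_isCompact (isCompact_closedBall (0:Euc2) (R+1))
    intro x hx
    by_contra hc
    apply hx
    apply hsupp
    simpa using hc
  obtain ⟨M, hM⟩ := hcs.fderiv ℝ |>.exists_bound_of_continuous hcont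
  have hzero : ∀ x, R + 1 < ‖x‖ → fderiv ℝ φ x = 0 := by
    intro x hx
    have : φ =ᶠ[𝓝 x] fun _ => 0 := by
      filter_upwards [(isOpen_lt continuous_const continuous_norm).mem_nhds hx] with y hy
      exact hsupp y hy
    rw [this.fderiv_eq]; simp
  set f : ℝ → ℝ := fun s => ∫ x in E, φ (x - s • h) with hf
  have hd : ∀ s ∈ Icc (0:ℝ) 1, HasDerivAt f (∫ x in E, fderiv ℝ φ (x - s • h) (-h)) s := by
    intro s hs
    refine (hasDerivAt_integral_of_dominated_loc_of_deriv_le (s := ball s 1)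
      (F := fun s x => φ (x - s • h))
      (F' := fun s x => fderiv ℝ φ (x - s • h) (-h))
      (bound := (closedBall (0:Euc2) (R+3)).indicator (fun _ => M))
      (ball_mem_nhds s one_pos) ?_ ?_ ?_ ?_ ?_ ?_).2
    · refine Eventually.of_forall fun s => ?_
      exact (hφ.continuous.comp (by fun_prop)).aestronglyMeasurable
    · apply Integrable.integrableOn
      exact ((hφ.continuous.integrable_of_hasCompactSupport hcs).comp_sub_right (s • h))
    · exact ((hcont.comp (by fun_prop : Continuous fun x : Euc2 => x - s • h)).clm_apply
        continuous_const).aestronglyMeasurable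
    · refine Eventually.of_forall fun x t ht => ?_
      have ht2 : |t| ≤ 2 := by
        rw [mem_ball, Real.dist_eq, abs_lt] at ht
        rw [abs_le]; constructor <;> linarith [hs.1, hs.2, ht.1, ht.2]
      by_cases hx : x ∈ closedBall (0:Euc2) (R+3)
      · rw [indicator_of_mem hx]
        calc _ ≤ ‖fderiv ℝ φ (x - t • h)‖ * ‖-h‖ := ContinuousLinearMap.le_opNorm _ _
          _ ≤ M * 1 := by
            rw [norm_neg]
            exact mul_le_mul (hM _) hh (norm_nonneg _) ((norm_nonneg _).trans (hM 0))
          _ = M := mul_one _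
      · rw [indicator_of_notMem hx, hzero]
        · simp
        · have : R + 3 < ‖x‖ := by simpa using hx
          have h3 : ‖t • h‖ ≤ 2 := by
            rw [norm_smul, Real.norm_eq_abs]
            nlinarith [abs_nonneg t]
          have := norm_sub_norm_le x (t • h)
          linarith
    · apply Integrable.integrableOn
      rw [integrable_indicator_iff measurableSet_closedBall]
      exact integrableOn_const (by exact (measure_closedBall_lt_top).ne)
    · refine Eventually.of_forall fun x t ht => ?_
      have h1 : HasDerivAt (fun t : ℝ => x - t • h) (-h) t := by
        simpa using ((hasDerivAt_id t).smul_const h).const_sub x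
      exact (hdiff (x - t • h)).hasFDerivAt.comp_hasDerivAt t h1
  have hb : ∀ s ∈ Icc (0:ℝ) 1, (∫ x in E, fderiv ℝ φ (x - s • h) (-h)) ≤ C * ‖h‖ := by
    intro s hs
    set ψ : Euc2 → ℝ := fun x => φ (x - s • h) with hψ
    have hψc : ContDiff ℝ 1 ψ := hφ.comp (by fun_prop)
    set e : Euc2 := ‖h‖⁻¹ • (-h) with he
    have hen : ‖e‖ = 1 := by
      rw [he, norm_smul, norm_neg, norm_inv, norm_norm]; field_simp
    have hsh : ‖s • h‖ ≤ 1 := by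
      rw [norm_smul, Real.norm_eq_abs, abs_of_nonneg hs.1]; nlinarith [hs.1, hs.2]
    have hts : tsupport (fun y => ψ y • e) ⊆ closedBall 0 (R+2) := by
      apply closure_minimal _ isClosed_closedBall
      intro x hx
      by_contra hc
      apply hx
      have : R + 2 < ‖x‖ := by simpa using hc
      have h2 := norm_sub_norm_le x (s • h)
      simp only [hψ]
      rw [hsupp _ (by linarith), zero_smul]
    have := hC (fun y => ψ y • e) (hψc.smul contDiff_const)
      (fun x => by rw [norm_smul, hen, mul_one]; exact hφ1 _)
      ((isCompact_closedBall (0:Euc2) (R+2)).of_isClosed_subset (isClosed_tsupport _) hts)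
      (hts.trans (closedBall_subset_ball (by linarith)))
    have heq : ∀ x, fderiv ℝ φ (x - s • h) (-h) = ‖h‖ * divg (fun y => ψ y • e) x := by
      intro x
      rw [divg_smul ψ hψc, hψ, fderiv_comp_sub, he, map_smul, smul_eq_mul]
      field_simp
    simp_rw [heq]
    rw [integral_const_mul, mul_comm]
    exact mul_le_mul_of_nonneg_right this hpos.le
  have := (convex_Icc (0:ℝ) 1).image_sub_le_mul_sub_of_deriv_le (f := f) (C := C * ‖h‖)
    (fun s hs => (hd s hs).continuousAt.continuousWithinAt)
    (fun s hs => (hd s (interior_subset hs)).differentiableAt.differentiableWithinAt)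
    (fun s hs => by rw [(hd s (interior_subset hs)).deriv]; exact hb s (interior_subset hs))
    0 (by simp) 1 (by simp) zero_le_one
  simpa [hf] using this

lemma diff_est (E F : Set Euc2) (hE : HasLocallyFinitePerimeter E) (hF : MeasurableSet F)
    (hEF : (volume : Measure Euc2).restrict E = volume.restrict F) (R : ℝ) :
    ∃ C : ℝ, 0 ≤ C ∧ ∀ h : Euc2, ‖h‖ ≤ 1 →
      volume ({x | ¬ (x ∈ F ↔ x + h ∈ F)} ∩ ball (0 : Euc2) R) ≤ ENNReal.ofReal (C * ‖h‖) := by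
  obtain ⟨C, hC⟩ := hE (ball 0 (R+3)) isOpen_ball isBounded_ball
  have hC0 : 0 ≤ C := by
    have := hC (fun _ => 0) contDiff_const (by simp) (by simp [tsupport]) (by simp [tsupport])
    have h2 : ∀ x, divg (fun _ => 0) x = 0 := by intro x; simp [divg]
    simpa [h2] using this
  refine ⟨C, hC0, fun h hh => ?_⟩
  set D : Set Euc2 := {x | ¬ (x ∈ F ↔ x + h ∈ F)} ∩ ball (0 : Euc2) R with hD
  have hFh : MeasurableSet {x : Euc2 | x + h ∈ F} := (measurable_add_const h) hF
  have hDm : MeasurableSet D := by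
    refine MeasurableSet.inter (MeasurableSet.compl ?_) measurableSet_ball
    exact MeasurableSet.iff hF hFh
  set g : Euc2 → ℝ := fun x => F.indicator 1 (x + h) - F.indicator 1 x with hg
  have hgm : Measurable g := by
    refine Measurable.sub ?_ (measurable_one.indicator hF)
    exact (measurable_one.indicator hF).comp (measurable_add_const h)
  have hg1 : ∀ x, |g x| ≤ 1 := by
    intro x
    simp only [hg, indicator, Pi.one_apply]
    split_ifs <;> simp
  set gR : Euc2 → ℝ := (ball (0:Euc2) R).indicator g with hgR
  have hgRm : Measurable gR := hgm.indicator measurableSet_ball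
  have hgR1 : ∀ x, |gR x| ≤ 1 := by
    intro x
    simp only [hgR, indicator]
    split_ifs
    · exact hg1 x
    · simp
  have hgRi : Integrable gR := by
    rw [hgR, integrable_indicator_iff measurableSet_ball]
    exact Measure.integrableOn_of_bounded (M := 1) measure_ball_lt_top.ne
      hgm.aestronglyMeasurable (Eventually.of_forall hg1)
  let bump : ℕ → ContDiffBump (0 : Euc2) := fun n =>
    ⟨1 / (2 * ((n:ℝ) + 1)), 1 / ((n:ℝ) + 1), by positivity, by
      apply one_div_lt_one_div_of_lt <;> [positivity; linarith [(Nat.cast_nonneg n : (0:ℝ) ≤ n)]]⟩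
  let φ : ℕ → Euc2 → ℝ := fun n =>
    convolution ((bump n).normed volume) gR (ContinuousLinearMap.lsmul ℝ ℝ) volume
  have hlim : ∀ᵐ x : Euc2, Tendsto (fun n => φ n x) atTop (𝓝 (gR x)) := by
    refine ContDiffBump.ae_convolution_tendsto_right_of_locallyIntegrable (K := 2) ?_ ?_
      hgRi.locallyIntegrable
    · exact tendsto_one_div_add_atTop_nhds_zero_nat
    · refine Eventually.of_forall fun n => le_of_eq ?_
      simp only [bump]; field_simp
  have hφc : ∀ n, ContDiff ℝ 1 (φ n) := by
    intro n
    exact HasCompactSupport.contDiff_convolution_left (n := 1) _ (bump n).hasCompactSupport_normed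
      (bump n).contDiff_normed hgRi.locallyIntegrable
  have hφ1 : ∀ n x, |φ n x| ≤ 1 := by
    intro n x
    calc |φ n x| = ‖∫ t, (bump n).normed volume t • gR (x - t)‖ := rfl
      _ ≤ ∫ t, (bump n).normed volume t := by
        apply norm_integral_le_of_norm_le (bump n).integrable_normed
        refine Eventually.of_forall fun t => ?_
        rw [norm_smul, Real.norm_eq_abs, Real.norm_eq_abs, abs_of_nonneg ((bump n).nonneg_normed _)]
        exact mul_le_of_le_one_right ((bump n).nonneg_normed _) (hgR1 _)
      _ = 1 := (bump n).integral_normed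
  have hφs : ∀ n x, R + 1 < ‖x‖ → φ n x = 0 := by
    intro n x hx
    change ∫ t, (bump n).normed volume t • gR (x - t) = 0
    apply integral_eq_zero_of_ae
    refine Eventually.of_forall fun t => ?_
    by_cases ht : t ∈ Function.support ((bump n).normed (volume : Measure Euc2))
    · rw [(bump n).support_normed_eq] at ht
      have h1 : ‖t‖ < 1 / ((n:ℝ)+1) := by simpa [bump] using ht
      have h2 : 1 / ((n:ℝ)+1) ≤ 1 := by
        rw [div_le_one (by positivity)]; linarith [(Nat.cast_nonneg n : (0:ℝ) ≤ n)]
      have h3 := norm_sub_norm_le x t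
      have : x - t ∉ ball (0:Euc2) R := by
        simp only [mem_ball, dist_zero_right, not_lt]; linarith
      simp [hgR, indicator_of_notMem this]
    · simp [Function.notMem_support.1 ht]
  have hφi : ∀ n, Integrable (φ n) := by
    intro n
    apply (hφc n).continuous.integrable_of_hasCompactSupport
    apply HasCompactSupport.of_support_subset_isCompact (isCompact_closedBall (0:Euc2) (R+1))
    intro x hx
    by_contra hc
    apply hx
    apply hφs
    simpa using hc
  have hmain : ∀ n, ∫ x, g x * φ n x ≤ C * ‖h‖ := by
    intro n
    have h1 := shift_est E R C hC (φ n) (hφc n) (hφ1 n) (hφs n) h hh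
    rw [hEF, ← integral_indicator hF, ← integral_indicator hF,
      ← integral_add_right_eq_self _ h, ← integral_sub] at h1
    · refine le_trans (le_of_eq (integral_congr_ae (Eventually.of_forall fun x => ?_))) h1
      simp only [hg, indicator, Pi.one_apply, add_sub_cancel_right]
      split_ifs <;> simp
    · exact (((hφi n).comp_sub_right h).indicator hF).comp_add_right h
    · exact (hφi n).indicator hF
  have hlim2 : Tendsto (fun n => ∫ x, g x * φ n x) atTop (𝓝 (∫ x, g x * gR x)) := by
    refine tendsto_integral_of_dominated_convergence
      ((closedBall (0:Euc2) (R+1)).indicator (fun _ => (1:ℝ))) ?_ ?_ ?_ ?_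
    · intro n
      exact hgm.aestronglyMeasurable.mul (hφc n).continuous.aestronglyMeasurable
    · rw [integrable_indicator_iff measurableSet_closedBall]
      exact integrableOn_const (measure_closedBall_lt_top).ne
    · intro n
      refine Eventually.of_forall fun x => ?_
      by_cases hx : x ∈ closedBall (0:Euc2) (R+1)
      · rw [indicator_of_mem hx, norm_mul]
        exact mul_le_one₀ (hg1 x) (norm_nonneg _) (hφ1 n x)
      · rw [indicator_of_notMem hx, hφs]
        · simp
        · simpa using hx
    · filter_upwards [hlim] with x hx
      exact hx.const_mul _
  have hle := le_of_tendsto' hlim2 hmain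
  have heq : ∀ x, g x * gR x = D.indicator 1 x := by
    intro x
    by_cases hb : x ∈ ball (0:Euc2) R
    · by_cases h1 : x ∈ F <;> by_cases h2 : x + h ∈ F <;>
        simp [hgR, hg, hD, indicator, h1, h2, -mem_ball, hb]
    · simp [hgR, hD, indicator, -mem_ball, hb]
  simp_rw [heq] at hle
  rw [integral_indicator_one hDm] at hle
  have hfin : volume D ≠ ⊤ :=
    ((measure_mono inter_subset_right).trans_lt measure_ball_lt_top).ne
  rw [← ENNReal.ofReal_toReal hfin]
  exact ENNReal.ofReal_le_ofReal hle

lemma avg_lemma {ι : Type*} (s : Finset ι) (z : ι → Euc2) (r : ℝ) (hr : 0 < r)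
    (A : Set Euc2) (hA : MeasurableSet A)
    (hdisj : ∀ i ∈ s, ∀ j ∈ s, i ≠ j → Disjoint (ball (z i) r) (ball (z j) r))
    (U : Set Euc2) (hU : ∀ i ∈ s, ball (z i) r ⊆ U) :
    ∃ ω ∈ ball (0 : Euc2) r, (({i | i ∈ s ∧ ω + z i ∈ A}.ncard : ℕ) : ENNReal) *
      volume (ball (0 : Euc2) r) ≤ volume (A ∩ U) := by
  classical
  have hm : ∀ i, MeasurableSet {ω | ω + z i ∈ A} := fun i => (measurable_add_const (z i)) hA
  have hcard : ∀ ω, (({i | i ∈ s ∧ ω + z i ∈ A}.ncard : ℕ) : ENNReal) =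
      ∑ i ∈ s, ({ω | ω + z i ∈ A} : Set Euc2).indicator 1 ω := by
    intro ω
    have : {i | i ∈ s ∧ ω + z i ∈ A} = ((s.filter fun i => ω + z i ∈ A : Finset ι) : Set ι) := by
      ext; simp
    rw [this, Set.ncard_coe_finset, Finset.card_filter]
    push_cast
    refine Finset.sum_congr rfl fun i _ => ?_
    simp [indicator]
  have hint : ∫⁻ ω in ball (0:Euc2) r, (({i | i ∈ s ∧ ω + z i ∈ A}.ncard : ℕ) : ENNReal)
      ≤ volume (A ∩ U) := by
    simp_rw [hcard]
    rw [lintegral_finsetSum]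
    · have : ∀ i ∈ s, ∫⁻ ω in ball (0:Euc2) r, ({ω | ω + z i ∈ A} : Set Euc2).indicator 1 ω
          = volume (A ∩ ball (z i) r) := by
        intro i _
        rw [lintegral_indicator_one (hm i), Measure.restrict_apply (hm i),
          ← measure_preimage_add_right volume (z i) (A ∩ ball (z i) r)]
        congr 1
        ext ω
        simp
      rw [Finset.sum_congr rfl this, ← measure_biUnion_finset]
      · apply measure_mono
        intro x hx
        simp only [mem_iUnion] at hx
        obtain ⟨i, hi, hx⟩ := hx
        exact ⟨hx.1, hU i hi hx.2⟩
      · intro i hi j hj hij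
        exact (hdisj i hi j hj hij).mono inter_subset_right inter_subset_right
      · intro i _
        exact hA.inter measurableSet_ball
    · intro i _
      exact measurable_one.indicator (hm i)
  by_contra hcon
  push Not at hcon
  have hv0 : volume (ball (0:Euc2) r) ≠ 0 := (measure_ball_pos _ _ hr).ne'
  obtain ⟨ω, hω, h⟩ := exists_le_setLAverage (μ := volume) (s := ball (0:Euc2) r)
    (f := fun ω => (({i | i ∈ s ∧ ω + z i ∈ A}.ncard : ℕ) : ENNReal)) hv0 measure_ball_lt_top.ne (by
      simp_rw [hcard]
      exact (Finset.measurable_fun_sum _ fun i _ => measurable_one.indicator (hm i)).aemeasurable)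
  have h2 := hcon ω hω
  rw [setLAverage_eq] at h
  have h3 := (ENNReal.le_div_iff_mul_le (Or.inl hv0) (Or.inl measure_ball_lt_top.ne)).1 h
  exact absurd (h3.trans hint) (not_le.2 h2)

lemma tele (f : ℕ → ZMod 2) (n : ℕ) :
    ∑ i ∈ Finset.range n, (f i + f (i+1)) = f 0 + f n := by
  induction n with
  | zero => simp [CharTwo.add_self_eq_zero]
  | succ k ih =>
    rw [Finset.sum_range_succ, ih]
    have := CharTwo.add_self_eq_zero (f k)
    linear_combination this

/-- `w` is constant across differing edges. -/
lemma comb (L w : ℕ → ℕ → ZMod 2) (N M : ℕ)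
    (hbot : ∀ i ≤ N + 1, L i 0 = 0) (htop : ∀ i ≤ N + 1, L i (M + 1) = 1)
    (hv : ∀ i < N, ∀ j < M + 1, L (i+1) j ≠ L (i+1) (j+1) → w i j = w (i+1) j)
    (hh : ∀ i < N + 1, ∀ j < M, L i (j+1) ≠ L (i+1) (j+1) → w i j = w i (j+1))
    (hl : ∀ j < M + 1, L 0 j ≠ L 0 (j+1) → w 0 j = 1) :
    ∃ j < M + 1, w N j ≠ 0 ∧ L (N+1) j ≠ L (N+1) (j+1) := by
  by_contra hcon
  push Not at hcon
  have z2 : ∀ x : ZMod 2, x + x = 0 := CharTwo.add_self_eq_zero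
  have hne : ∀ x y : ZMod 2, x ≠ y → x + y = 1 := by decide
  -- modified edge functions
  have hV : ∀ j < M + 1, ∑ i ∈ Finset.range (N+1),
      w i j * ((L i j + L i (j+1)) + (L (i+1) j + L (i+1) (j+1))) = L 0 j + L 0 (j+1) := by
    intro j hj
    have key : ∀ n ≤ N, ∑ i ∈ Finset.range (n+1),
      w i j * ((L i j + L i (j+1)) + (L (i+1) j + L (i+1) (j+1)))
        = w 0 j * (L 0 j + L 0 (j+1)) + w n j * (L (n+1) j + L (n+1) (j+1)) := by
      intro n
      induction n with
      | zero => intro _; simp; ring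
      | succ k ih =>
        intro hk
        rw [Finset.sum_range_succ, ih (by omega)]
        by_cases he : L (k+1) j = L (k+1) (j+1)
        · rw [he]
          have := z2 (L (k+1) (j+1))
          linear_combination (w k j + w (k+1) j) * this
        · rw [hv k (by omega) j hj he]
          have := z2 (w (k+1) j * (L (k+1) j + L (k+1) (j+1)))
          linear_combination this
    rw [key N le_rfl]
    have e1 : w 0 j * (L 0 j + L 0 (j+1)) = L 0 j + L 0 (j+1) := by
      by_cases he : L 0 j = L 0 (j+1)
      · rw [he, z2, mul_zero]
      · rw [hl j hj he, one_mul]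
    have e2 : w N j * (L (N+1) j + L (N+1) (j+1)) = 0 := by
      by_cases he : w N j = 0
      · rw [he, zero_mul]
      · rw [hcon j hj he, z2, mul_zero]
    rw [e1, e2, add_zero]
  have hH : ∀ i < N + 1, ∑ j ∈ Finset.range (M+1),
      w i j * ((L i j + L (i+1) j) + (L i (j+1) + L (i+1) (j+1))) = 0 := by
    intro i hi
    have key : ∀ n ≤ M, ∑ j ∈ Finset.range (n+1),
      w i j * ((L i j + L (i+1) j) + (L i (j+1) + L (i+1) (j+1)))
        = w i 0 * (L i 0 + L (i+1) 0) + w i n * (L i (n+1) + L (i+1) (n+1)) := by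
      intro n
      induction n with
      | zero => intro _; simp; ring
      | succ k ih =>
        intro hk
        rw [Finset.sum_range_succ, ih (by omega)]
        by_cases he : L i (k+1) = L (i+1) (k+1)
        · rw [he]
          have := z2 (L (i+1) (k+1))
          linear_combination (w i k + w i (k+1)) * this
        · rw [hh i hi k (by omega) he]
          have := z2 (w i (k+1) * (L i (k+1) + L (i+1) (k+1)))
          linear_combination this
    rw [key M le_rfl, hbot i (by omega), hbot (i+1) (by omega), htop i (by omega),
      htop (i+1) (by omega), z2, z2]
    simp
  have s1 := Finset.sum_congr rfl (fun j (hj : j ∈ Finset.range (M+1)) =>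
    hV j (Finset.mem_range.1 hj))
  have s2 := Finset.sum_congr rfl (fun i (hi : i ∈ Finset.range (N+1)) =>
    hH i (Finset.mem_range.1 hi))
  rw [tele (fun j => L 0 j), hbot 0 (by omega), htop 0 (by omega), Finset.sum_comm] at s1
  have s3 : ∀ i j, w i j * ((L i j + L i (j+1)) + (L (i+1) j + L (i+1) (j+1))) =
      w i j * ((L i j + L (i+1) j) + (L i (j+1) + L (i+1) (j+1))) := by intros; ring
  simp_rw [s3] at s1
  rw [s1] at s2
  simp at s2

lemma limit_curve (K : Set Euc2) (hK : IsCompact K) (C : ℝ) (hC : 0 ≤ C) (k : ℕ → ℕ)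
    (x : ℕ → ℕ → Euc2) (hx : ∀ n i, x n i ∈ K) (ε : ℕ → ℝ) (hε : Tendsto ε atTop (𝓝 0))
    (hstep : ∀ n i, dist (x n i) (x n (i+1)) ≤ ε n) (hlen : ∀ n, k n * ε n ≤ C) :
    ∃ (γ : ℝ → Euc2) (l : Ultrafilter ℕ), (l : Filter ℕ) ≤ atTop ∧
      LipschitzOnWith C.toNNReal γ (Icc 0 1) ∧ (∀ t, γ t ∈ K) ∧
      Tendsto (fun n => x n 0) l (𝓝 (γ 0)) ∧ Tendsto (fun n => x n (k n)) l (𝓝 (γ 1)) := by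
  let l : Ultrafilter ℕ := Ultrafilter.of atTop
  have hl : (l : Filter ℕ) ≤ atTop := Ultrafilter.of_le _
  have hεn : ∀ n, 0 ≤ ε n := fun n => dist_nonneg.trans (hstep n 0)
  have hdist : ∀ n i j, i ≤ j → dist (x n i) (x n j) ≤ (j - i : ℝ) * ε n := by
    intro n i j hij
    induction j, hij using Nat.le_induction with
    | base => simp
    | succ j hj ih =>
      calc _ ≤ dist (x n i) (x n j) + dist (x n j) (x n (j+1)) := dist_triangle _ _ _
        _ ≤ (j - i : ℝ) * ε n + ε n := add_le_add ih (hstep n j)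
        _ = _ := by push_cast; ring
  have hex : ∀ t : ℝ, ∃ y ∈ K, Tendsto (fun n => x n ⌊k n * t⌋₊) l (𝓝 y) := by
    intro t
    have := hK.ultrafilter_le_nhds (l.map (fun n => x n ⌊k n * t⌋₊)) (by
      rw [le_principal_iff]
      exact Filter.Eventually.of_forall (f := (l : Filter ℕ)) fun n => hx n _)
    exact this
  choose γ hγK hγ using hex
  refine ⟨γ, l, hl, ?_, hγK, ?_, ?_⟩
  · have main : ∀ s ∈ Icc (0:ℝ) 1, ∀ t ∈ Icc (0:ℝ) 1, s ≤ t → dist (γ s) (γ t) ≤ C * (t - s) := by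
      intro s hs t ht hst
      have h1 : Tendsto (fun n => dist (x n ⌊k n * s⌋₊) (x n ⌊k n * t⌋₊)) l
        (𝓝 (dist (γ s) (γ t))) := (hγ s).dist (hγ t)
      have h2 : Tendsto (fun n => C * (t - s) + ε n) l (𝓝 (C * (t - s) + 0)) :=
        tendsto_const_nhds.add (hε.mono_left hl)
      rw [add_zero] at h2
      refine le_of_tendsto_of_tendsto' h1 h2 fun n => ?_
      have hk0 : (0:ℝ) ≤ k n := Nat.cast_nonneg _
      have hfl : ⌊k n * s⌋₊ ≤ ⌊k n * t⌋₊ := Nat.floor_mono (by gcongr)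
      refine (hdist n _ _ hfl).trans ?_
      have f1 : (⌊k n * t⌋₊ : ℝ) ≤ k n * t := Nat.floor_le (mul_nonneg hk0 ht.1)
      have f2 : k n * s < ⌊k n * s⌋₊ + 1 := Nat.lt_floor_add_one _
      calc _ ≤ (k n * (t - s) + 1) * ε n := by
            apply mul_le_mul_of_nonneg_right _ (hεn n); nlinarith
        _ = k n * ε n * (t - s) + ε n := by ring
        _ ≤ _ := by
            have := mul_le_mul_of_nonneg_right (hlen n) (sub_nonneg.2 hst)
            linarith
    apply LipschitzOnWith.of_dist_le_mul
    intro s hs t ht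
    rw [Real.coe_toNNReal _ hC, Real.dist_eq]
    rcases le_total s t with h | h
    · rw [abs_sub_comm, abs_of_nonneg (sub_nonneg.2 h)]; exact main s hs t ht h
    · rw [dist_comm, abs_of_nonneg (sub_nonneg.2 h)]; exact main t ht s hs h
  · simpa using hγ 0
  · simpa using hγ 1

lemma chain_exists (E F : Set Euc2) (u m : Euc2) (hu : ‖u‖ = 1) (hm : ‖m‖ = 1)
    (hum : inner ℝ u m = 0) (c : ℝ) (hF : MeasurableSet F)
    (hseg : ∀ p ∈ F, ∀ q ∉ F, ∃ y ∈ segment ℝ p q, y ∈ frontier E)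
    (hFout : ∀ x, 1 < ‖x‖ → (x ∈ F ↔ c * |inner ℝ u x| ≤ inner ℝ m x))
    (hdiff : ∀ R : ℝ, ∃ C : ℝ, 0 ≤ C ∧ ∀ h : Euc2, ‖h‖ ≤ 1 →
      volume ({x | ¬ (x ∈ F ↔ x + h ∈ F)} ∩ ball (0 : Euc2) R) ≤ ENNReal.ofReal (C * ‖h‖)) :
    ∃ C R₀ : ℝ, 0 ≤ C ∧ ∀ n : ℕ, ∃ (k : ℕ) (x : ℕ → Euc2),
      (∀ i, x i ∈ frontier E ∩ closedBall 0 R₀) ∧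
      (∀ i, dist (x i) (x (i+1)) ≤ 5 * (1 / ((n:ℝ) + 1))) ∧
      k * (5 * (1 / ((n:ℝ) + 1))) ≤ C ∧
      |inner ℝ u (x 0) + 2| ≤ 4 * (1 / ((n:ℝ) + 1)) ∧
      |inner ℝ u (x k) - 2| ≤ 4 * (1 / ((n:ℝ) + 1)) := by
  classical
  obtain ⟨T, hT⟩ := exists_nat_ge (3 * |c| + 3)
  have hc0 : 0 ≤ |c| := abs_nonneg c
  obtain ⟨C, hC0, hC⟩ := hdiff (T + 3 + 1)
  have hmu : inner ℝ m u = 0 := by rw [real_inner_comm]; exact hum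
  have huu : inner ℝ u u = (1:ℝ) := by rw [real_inner_self_eq_norm_sq, hu]; norm_num
  have hmm : inner ℝ m m = (1:ℝ) := by rw [real_inner_self_eq_norm_sq, hm]; norm_num
  set κ : ℝ := (volume (ball (0:Euc2) 1)).toReal with hκ
  have hκ0 : 0 < κ := ENNReal.toReal_pos (measure_ball_pos _ _ one_pos).ne' measure_ball_lt_top.ne
  refine ⟨5 * (12 * C / κ), T + 5, by positivity, fun n => ?_⟩
  set ε : ℝ := 1 / ((n:ℝ) + 1) with hε
  have hn0 : (0:ℝ) ≤ n := Nat.cast_nonneg n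
  have hε0 : 0 < ε := by positivity
  have hε1 : ε ≤ 1 := by rw [hε, div_le_one (by positivity)]; linarith
  have hεn : ε * (n + 1) = 1 := by rw [hε]; field_simp
  have hT3 : (3:ℝ) ≤ T := by linarith
  have hTn : 3 ≤ T := by exact_mod_cast hT3
  obtain ⟨N, hN⟩ : ∃ N, N + 1 = 4 * (n + 1) := ⟨4 * n + 3, by ring⟩
  obtain ⟨M, hM⟩ : ∃ M, M + 1 = 2 * T * (n + 1) :=
    ⟨2 * T * (n + 1) - 1, Nat.sub_add_cancel (by nlinarith)⟩
  have hNr : ((N:ℝ) + 1) * ε = 4 := by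
    have : ((N:ℝ) + 1) = 4 * (n + 1) := by exact_mod_cast hN
    rw [this]; linear_combination 4 * hεn
  have hMr : ((M:ℝ) + 1) * ε = 2 * T := by
    have : ((M:ℝ) + 1) = 2 * T * (n + 1) := by exact_mod_cast hM
    rw [this]; linear_combination 2 * T * hεn
  -- bad points
  set A : Set Euc2 := {x | ¬ ((x ∈ F ↔ x + ε • u ∈ F) ∧ (x ∈ F ↔ x + ε • m ∈ F) ∧
    (x + ε • u ∈ F ↔ x + ε • u + ε • m ∈ F))} with hA
  have hshift : ∀ h : Euc2, MeasurableSet {x : Euc2 | x + h ∈ F} :=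
    fun h => (measurable_add_const h) hF
  have hAm : MeasurableSet A := by
    refine MeasurableSet.compl (MeasurableSet.inter (hF.iff (hshift _))
      (MeasurableSet.inter (hF.iff (hshift _)) ((hshift _).iff ?_)))
    simpa only [add_assoc] using hshift (ε • u + ε • m)
  have hεu : ‖ε • u‖ = ε := by rw [norm_smul, hu, Real.norm_eq_abs, abs_of_pos hε0, mul_one]
  have hεm : ‖ε • m‖ = ε := by rw [norm_smul, hm, Real.norm_eq_abs, abs_of_pos hε0, mul_one]
  have hAvol : volume (A ∩ ball 0 (T + 3)) ≤ ENNReal.ofReal (3 * C * ε) := by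
    have c1 := hC (ε • u) (by rw [hεu]; exact hε1)
    have c2 := hC (ε • m) (by rw [hεm]; exact hε1)
    rw [hεu] at c1
    rw [hεm] at c2
    set D1 := {x | ¬ (x ∈ F ↔ x + ε • u ∈ F)} ∩ ball (0 : Euc2) (T + 3 + 1)
    set D2 := {x | ¬ (x ∈ F ↔ x + ε • m ∈ F)} ∩ ball (0 : Euc2) (T + 3 + 1) with hD2
    have hsub : A ∩ ball 0 (T + 3) ⊆ D1 ∪ (D2 ∪ (fun x => x + ε • u) ⁻¹' D2) := by
      rintro x ⟨hx, hxb⟩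
      have hb1 : x ∈ ball (0:Euc2) (T+3+1) := ball_subset_ball (by linarith) hxb
      have hb2 : x + ε • u ∈ ball (0:Euc2) (T+3+1) := by
        simp only [mem_ball, dist_zero_right] at hxb ⊢
        have := norm_add_le x (ε • u)
        linarith
      by_cases k1 : x ∈ F ↔ x + ε • u ∈ F
      · by_cases k2 : x ∈ F ↔ x + ε • m ∈ F
        · by_cases k3 : x + ε • u ∈ F ↔ x + ε • u + ε • m ∈ F
          · exact absurd ⟨k1, k2, k3⟩ hx
          · exact Or.inr (Or.inr ⟨k3, hb2⟩)
        · exact Or.inr (Or.inl ⟨k2, hb1⟩)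
      · exact Or.inl ⟨k1, hb1⟩
    calc _ ≤ volume D1 + (volume D2 + volume ((fun x => x + ε • u) ⁻¹' D2)) :=
          (measure_mono hsub).trans ((measure_union_le _ _).trans
            (by gcongr; exact measure_union_le _ _))
      _ ≤ ENNReal.ofReal (C * ε) + (ENNReal.ofReal (C * ε) + ENNReal.ofReal (C * ε)) := by
          rw [measure_preimage_add_right]
          gcongr
      _ = _ := by
          rw [← ENNReal.ofReal_add, ← ENNReal.ofReal_add] <;> [congr 1; skip; skip; skip; skip] <;>
            [ring; positivity; positivity; positivity; positivity]
  let z : ℕ × ℕ → Euc2 := fun f => (-2 + f.1 * ε) • u + (-T + f.2 * ε) • m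
  have hzu : ∀ f, inner ℝ u (z f) = -2 + f.1 * ε := by
    intro f; simp [z, inner_add_right, inner_smul_right, hu, hum]
  have hzm : ∀ f, inner ℝ m (z f) = -T + f.2 * ε := by
    intro f; simp [z, inner_add_right, inner_smul_right, hm, hmu]
  set s : Finset (ℕ × ℕ) := Finset.range (N+1) ×ˢ Finset.range (M+1) with hs
  have hru : ∀ i ≤ N + 1, |-2 + (i:ℝ) * ε| ≤ 2 := by
    intro i hi
    have : (i:ℝ) ≤ N + 1 := by exact_mod_cast hi
    have h1 := mul_le_mul_of_nonneg_right this hε0.le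
    have h2 : 0 ≤ (i:ℝ) * ε := by positivity
    rw [abs_le]; constructor <;> linarith
  have hrm : ∀ i ≤ M + 1, |-(T:ℝ) + (i:ℝ) * ε| ≤ T := by
    intro i hi
    have : (i:ℝ) ≤ M + 1 := by exact_mod_cast hi
    have h1 := mul_le_mul_of_nonneg_right this hε0.le
    have h2 : 0 ≤ (i:ℝ) * ε := by positivity
    rw [abs_le]; constructor <;> linarith
  have hzn : ∀ f ∈ s, ‖z f‖ ≤ T + 2 := by
    intro f hf
    simp only [hs, Finset.mem_product, Finset.mem_range] at hf
    calc ‖z f‖ ≤ ‖(-2 + f.1 * ε) • u‖ + ‖(-T + f.2 * ε) • m‖ := norm_add_le _ _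
      _ = |-2 + f.1 * ε| + |-T + f.2 * ε| := by
        rw [norm_smul, norm_smul, hu, hm, Real.norm_eq_abs, Real.norm_eq_abs, mul_one, mul_one]
      _ ≤ 2 + T := add_le_add (hru _ hf.1.le) (hrm _ hf.2.le)
      _ = _ := by ring
  have hint : ∀ i j : ℕ, i ≠ j → ε ≤ |(i:ℝ) * ε - j * ε| := by
    intro i j hij
    rw [← sub_mul, abs_mul, abs_of_pos hε0]
    have : (1:ℝ) ≤ |(i:ℝ) - j| := by
      have h : (1:ℤ) ≤ |(i:ℤ) - j| := Int.one_le_abs (by omega)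
      exact_mod_cast h
    nlinarith
  obtain ⟨ω, hω, hcard⟩ := avg_lemma s z (ε / 2) (by positivity) A hAm (by
      intro f hf g hg hfg
      apply ball_disjoint_ball
      rw [add_halves, dist_eq_norm]
      by_cases h1 : f.1 = g.1
      · have h2 : f.2 ≠ g.2 := fun h2 => hfg (Prod.ext h1 h2)
        have := abs_real_inner_le_norm m (z f - z g)
        rw [hm, one_mul, inner_sub_right, hzm, hzm] at this
        refine (hint _ _ h2).trans (le_trans (le_of_eq ?_) this)
        congr 1; ring
      · have := abs_real_inner_le_norm u (z f - z g)
        rw [hu, one_mul, inner_sub_right, hzu, hzu] at this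
        refine (hint _ _ h1).trans (le_trans (le_of_eq ?_) this)
        congr 1; ring) (ball 0 (T+3)) (by
      intro f hf x hx
      have := hzn f hf
      rw [mem_ball, dist_eq_norm] at hx
      rw [mem_ball, dist_zero_right]
      have h2 := norm_add_le (x - z f) (z f)
      rw [sub_add_cancel] at h2
      linarith)
  have hωn : ‖ω‖ ≤ ε / 2 := (by simpa using hω : ‖ω‖ < ε / 2).le
  have hωu : |inner ℝ u ω| ≤ ε / 2 := by
    have := abs_real_inner_le_norm u ω
    rw [hu, one_mul] at this; linarith
  have hωm : |inner ℝ m ω| ≤ ε / 2 := by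
    have := abs_real_inner_le_norm m ω
    rw [hm, one_mul] at this; linarith
  set B : Set (ℕ × ℕ) := {f | f ∈ s ∧ ω + z f ∈ A} with hB
  have hBfin : B.Finite := s.finite_toSet.subset fun f hf => hf.1
  have hBcard : (B.ncard : ℝ) * ε ≤ 12 * C / κ := by
    have h1 := hcard.trans hAvol
    rw [Measure.addHaar_ball volume _ (by positivity : 0 ≤ ε / 2)] at h1
    have h2 := ENNReal.toReal_mono ENNReal.ofReal_ne_top h1
    rw [ENNReal.toReal_ofReal (by positivity), ENNReal.toReal_mul, ENNReal.toReal_mul,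
      ENNReal.toReal_ofReal (by positivity), ENNReal.toReal_natCast, ← hκ] at h2
    simp only [finrank_euclideanSpace, Fintype.card_fin] at h2
    rw [le_div_iff₀ hκ0]
    have h3 : ((B.ncard : ℝ) * ε * κ) * ε ≤ (12 * C) * ε := by nlinarith
    exact le_of_mul_le_mul_right h3 hε0
  let P : ℕ → ℕ → Euc2 := fun i j => ω + z (i, j)
  have hPu : ∀ i j, P (i+1) j = P i j + ε • u := by
    intro i j; simp only [P, z]; push_cast; module
  have hPm : ∀ i j, P i (j+1) = P i j + ε • m := by
    intro i j; simp only [P, z]; push_cast; module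
  have hPiu : ∀ i j, inner ℝ u (P i j) = inner ℝ u ω + (-2 + i * ε) := by
    intro i j; simp only [P]; rw [inner_add_right, hzu]
  have hPim : ∀ i j, inner ℝ m (P i j) = inner ℝ m ω + (-T + j * ε) := by
    intro i j; simp only [P]; rw [inner_add_right, hzm]
  -- frontier points near bad faces
  have hy : ∀ f : B, ∃ y ∈ frontier E, dist y (P f.1.1 f.1.2) ≤ 2 * ε := by
    rintro ⟨⟨i, j⟩, hf⟩
    have hbad : P i j ∈ A := hf.2
    have hball : ∀ p q : Euc2, p ∈ closedBall (P i j) (2*ε) → q ∈ closedBall (P i j) (2*ε) →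
        ¬ (p ∈ F ↔ q ∈ F) → ∃ y ∈ frontier E, dist y (P i j) ≤ 2 * ε := by
      intro p q hp hq hpq
      by_cases hpF : p ∈ F
      · obtain ⟨y, hy1, hy2⟩ := hseg p hpF q (by tauto)
        exact ⟨y, hy2, (convex_closedBall _ _).segment_subset hp hq hy1⟩
      · obtain ⟨y, hy1, hy2⟩ := hseg q (by tauto) p hpF
        exact ⟨y, hy2, (convex_closedBall _ _).segment_subset hq hp hy1⟩
    have b0 : P i j ∈ closedBall (P i j) (2*ε) := mem_closedBall_self (by positivity)
    have b1 : P i j + ε • u ∈ closedBall (P i j) (2*ε) := by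
      rw [mem_closedBall, dist_self_add_left, hεu]; linarith
    have b2 : P i j + ε • m ∈ closedBall (P i j) (2*ε) := by
      rw [mem_closedBall, dist_self_add_left, hεm]; linarith
    have b3 : P i j + ε • u + ε • m ∈ closedBall (P i j) (2*ε) := by
      rw [mem_closedBall, add_assoc, dist_self_add_left]
      have := norm_add_le (ε • u) (ε • m)
      linarith
    by_cases k1 : P i j ∈ F ↔ P i j + ε • u ∈ F
    · by_cases k2 : P i j ∈ F ↔ P i j + ε • m ∈ F
      · by_cases k3 : P i j + ε • u ∈ F ↔ P i j + ε • u + ε • m ∈ F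
        · exact absurd ⟨k1, k2, k3⟩ hbad
        · exact hball _ _ b1 b3 k3
      · exact hball _ _ b0 b2 k2
    · exact hball _ _ b0 b1 k1
  choose y hyE hyd using hy
  let G : SimpleGraph B := SimpleGraph.fromRel fun f g =>
    (g.1.1 = f.1.1 + 1 ∧ g.1.2 = f.1.2) ∨ (g.1.1 = f.1.1 ∧ g.1.2 = f.1.2 + 1)
  have hGd : ∀ f g : B, G.Adj f g → dist (y f) (y g) ≤ 5 * ε := by
    have key : ∀ f g : B, ((g.1.1 = f.1.1 + 1 ∧ g.1.2 = f.1.2) ∨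
        (g.1.1 = f.1.1 ∧ g.1.2 = f.1.2 + 1)) → dist (y f) (y g) ≤ 5 * ε := by
      intro f g h
      have hd : dist (P f.1.1 f.1.2) (P g.1.1 g.1.2) = ε := by
        rcases h with ⟨h1, h2⟩ | ⟨h1, h2⟩
        · rw [h1, h2, hPu, dist_self_add_right, hεu]
        · rw [h1, h2, hPm, dist_self_add_right, hεm]
      have h1 := dist_triangle4 (y f) (P f.1.1 f.1.2) (P g.1.1 g.1.2) (y g)
      have h2 := hyd f
      have h3 := hyd g
      rw [dist_comm] at h3
      linarith
    intro f g h
    rw [SimpleGraph.fromRel_adj] at h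
    rcases h.2 with h | h
    · exact key f g h
    · rw [dist_comm]; exact key g f h
  let L : ℕ → ℕ → ZMod 2 := fun i j => if P i j ∈ F then 1 else 0
  have hL : ∀ i j i' j', L i j ≠ L i' j' → ¬ (P i j ∈ F ↔ P i' j' ∈ F) := by
    intro i j i' j' h h2
    apply h
    simp only [L, h2]
  let Q : ℕ → ℕ → Prop := fun i j => ∃ (h : (i, j) ∈ B) (v : B), v.1.1 = 0 ∧ G.Reachable v ⟨(i,j), h⟩
  let w : ℕ → ℕ → ZMod 2 := fun i j => if Q i j then 1 else 0
  have hmemB : ∀ i j, i < N + 1 → j < M + 1 → P i j ∈ A → (i, j) ∈ B := by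
    intro i j hi hj h
    exact ⟨by simp [hs, hi, hj], h⟩
  have hwQ : ∀ i j i' j', (Q i j ↔ Q i' j') → w i j = w i' j' := by
    intro i j i' j' h
    simp only [w, h]
  have hQadj : ∀ i j i' j' (h : (i, j) ∈ B) (h' : (i', j') ∈ B), G.Adj ⟨_, h⟩ ⟨_, h'⟩ →
      (Q i j ↔ Q i' j') := by
    intro i j i' j' h h' hadj
    constructor
    · rintro ⟨_, v, hv, hr⟩
      exact ⟨h', v, hv, hr.trans hadj.reachable⟩
    · rintro ⟨_, v, hv, hr⟩
      exact ⟨h, v, hv, hr.trans hadj.symm.reachable⟩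
  have hPbig : ∀ i j : ℕ, |-(T:ℝ) + (j:ℝ) * ε| = T → 1 < ‖P i j‖ := by
    intro i j h
    have h1 := abs_real_inner_le_norm m (P i j)
    rw [hm, one_mul, hPim] at h1
    have h2 := abs_sub_abs_le_abs_sub (-(T:ℝ) + (j:ℝ) * ε) (-(inner ℝ m ω))
    rw [sub_neg_eq_add, abs_neg, add_comm (-(T:ℝ) + (j:ℝ) * ε) (inner ℝ m ω)] at h2
    linarith
  have hPu25 : ∀ i j, i ≤ N + 1 → |inner ℝ u (P i j)| ≤ 5 / 2 := by
    intro i j hi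
    rw [hPiu]
    have := abs_add_le (inner ℝ u ω) (-2 + i * ε)
    have h2 := hru i hi
    linarith
  obtain ⟨j, hj, hwj, -⟩ := comb L w N M (by
      intro i hi
      have h1 : 1 < ‖P i 0‖ := hPbig i 0 (by simp)
      have h2 := hPu25 i 0 hi
      have : P i 0 ∉ F := by
        rw [hFout _ h1, not_le, hPim]
        have h3 := (abs_le.1 hωm).2
        have h4 : |c| * |inner ℝ u (P i 0)| ≤ |c| * (5/2) := mul_le_mul_of_nonneg_left h2 hc0
        have h5 : -|c| * |inner ℝ u (P i 0)| ≤ c * |inner ℝ u (P i 0)| :=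
          mul_le_mul_of_nonneg_right (neg_abs_le c) (abs_nonneg _)
        simp only [Nat.cast_zero, zero_mul]
        linarith
      simp only [L, if_neg this]) (by
      intro i hi
      have hMT : -(T:ℝ) + ((M + 1 : ℕ) : ℝ) * ε = T := by push_cast; linarith
      have h1 : 1 < ‖P i (M+1)‖ := hPbig i (M+1) (by
        rw [hMT]; exact abs_of_nonneg (by linarith))
      have h2 := hPu25 i (M+1) hi
      have : P i (M+1) ∈ F := by
        rw [hFout _ h1, hPim, hMT]
        have h3 := (abs_le.1 hωm).1
        have h4 : |c| * |inner ℝ u (P i (M+1))| ≤ |c| * (5/2) := mul_le_mul_of_nonneg_left h2 hc0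
        have h5 : c * |inner ℝ u (P i (M+1))| ≤ |c| * |inner ℝ u (P i (M+1))| :=
          mul_le_mul_of_nonneg_right (le_abs_self c) (abs_nonneg _)
        linarith
      simp only [L, if_pos this]) (by
      intro i hi j hj hne
      have hne' := hL _ _ _ _ hne
      rw [hPm] at hne'
      have hb1 : (i, j) ∈ B := hmemB i j (by omega) hj (by
        rintro ⟨-, -, h⟩
        rw [hPu] at hne'
        exact hne' h)
      have hb2 : (i+1, j) ∈ B := hmemB (i+1) j (by omega) hj (by
        rintro ⟨-, h, -⟩
        exact hne' h)
      apply hwQ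
      apply hQadj i j (i+1) j hb1 hb2
      rw [SimpleGraph.fromRel_adj]
      exact ⟨by simp, Or.inl (Or.inl ⟨rfl, rfl⟩)⟩) (by
      intro i hi j hj hne
      have hne' := hL _ _ _ _ hne
      have hb1 : (i, j) ∈ B := hmemB i j hi (by omega) (by
        rintro ⟨h1, h2, h3⟩
        rw [hPm, hPm, hPu] at hne'
        tauto)
      have hb2 : (i, j+1) ∈ B := hmemB i (j+1) hi (by omega) (by
        rintro ⟨h, -, -⟩
        rw [hPu] at hne'
        exact hne' h)
      apply hwQ
      apply hQadj i j i (j+1) hb1 hb2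
      rw [SimpleGraph.fromRel_adj]
      exact ⟨by simp, Or.inl (Or.inr ⟨rfl, rfl⟩)⟩) (by
      intro j hj hne
      have hne' := hL _ _ _ _ hne
      rw [hPm] at hne'
      have hb : (0, j) ∈ B := hmemB 0 j (by omega) hj (by
        rintro ⟨-, h, -⟩
        exact hne' h)
      have : Q 0 j := ⟨hb, ⟨_, hb⟩, rfl, SimpleGraph.Reachable.refl _⟩
      simp only [w, if_pos this])
  have hQ : Q N j := by
    by_contra h
    exact hwj (by simp only [w, if_neg h])
  obtain ⟨hBj, v, hv0, hreach⟩ := hQ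
  obtain ⟨p, hp⟩ := hreach.exists_isPath
  have : Fintype B := hBfin.fintype
  have hplen := hp.length_lt
  rw [← Nat.card_eq_fintype_card, Nat.card_coe_set_eq] at hplen
  have hyu : ∀ f : B, |inner ℝ u (y f) - (-2 + f.1.1 * ε)| ≤ 5 / 2 * ε := by
    intro f
    have h1 := abs_real_inner_le_norm u (y f - P f.1.1 f.1.2)
    rw [hu, one_mul, ← dist_eq_norm, inner_sub_right, hPiu] at h1
    have h2 := h1.trans (hyd f)
    rw [abs_le] at h2 hωu ⊢
    constructor <;> linarith [h2.1, h2.2, hωu.1, hωu.2]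
  refine ⟨p.length, fun i => y (p.getVert i), ?_, ?_, ?_, ?_, ?_⟩
  · intro i
    refine ⟨hyE _, ?_⟩
    rw [mem_closedBall, dist_zero_right]
    set f := p.getVert i
    have h1 := hyd f
    have h2 := hzn f.1 f.2.1
    have h3 : ‖P f.1.1 f.1.2‖ ≤ ‖ω‖ + ‖z f.1‖ := norm_add_le _ _
    have h4 := norm_add_le (y f - P f.1.1 f.1.2) (P f.1.1 f.1.2)
    rw [sub_add_cancel, ← dist_eq_norm] at h4
    linarith
  · intro i
    by_cases hi : i < p.length
    · exact hGd _ _ (p.adj_getVert_succ hi)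
    · show dist (y (p.getVert i)) (y (p.getVert (i+1))) ≤ 5 * ε
      rw [p.getVert_of_length_le (show p.length ≤ i by omega),
        p.getVert_of_length_le (show p.length ≤ i + 1 by omega), dist_self]
      positivity
  · have h1 : (p.length : ℝ) ≤ B.ncard := by exact_mod_cast hplen.le
    have h2 := mul_le_mul_of_nonneg_right h1 hε0.le
    linarith
  · simp only [SimpleGraph.Walk.getVert_zero]
    have := hyu v
    rw [hv0, abs_le] at this
    simp only [Nat.cast_zero, zero_mul] at this
    rw [abs_le]
    constructor <;> linarith [this.1, this.2]
  · simp only [SimpleGraph.Walk.getVert_length]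
    have := hyu ⟨(N, j), hBj⟩
    rw [abs_le] at this ⊢
    simp only at this
    constructor <;> linarith [this.1, this.2]

lemma circ_inner (s t : ℝ) : inner ℝ (circ s) (circ t) = Real.cos (s - t) := by
  simp [circ, EuclideanSpace.inner_eq_star_dotProduct, Real.cos_sub, dotProduct, Fin.sum_univ_two]
  ring

lemma circ_norm (s : ℝ) : ‖circ s‖ = 1 := by
  have h := circ_inner s s
  rw [real_inner_self_eq_norm_sq, sub_self, Real.cos_zero] at h
  have h0 := norm_nonneg (circ s)
  nlinarith

lemma circ_add (s t : ℝ) : circ (s + t) = Real.cos t • circ s + Real.sin t • circ (s + Real.pi / 2) := by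
  ext i
  fin_cases i
  · simp [circ, Real.cos_add]; ring
  · simp [circ, Real.sin_add, Real.cos_add]; ring

lemma circ_expand (s : ℝ) (x : Euc2) :
    x = inner ℝ (circ s) x • circ s + inner ℝ (circ (s + Real.pi / 2)) x • circ (s + Real.pi / 2) := by
  have h := Real.sin_sq_add_cos_sq s
  ext i
  fin_cases i
  · simp [circ, EuclideanSpace.inner_eq_star_dotProduct, dotProduct, Fin.sum_univ_two, Real.sin_add, Real.cos_add]
    linear_combination - x 0 * h
  · simp [circ, EuclideanSpace.inner_eq_star_dotProduct, dotProduct, Fin.sum_univ_two, Real.sin_add, Real.cos_add]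
    linear_combination - x 1 * h

lemma circ_sphere (s : ℝ) (x : Euc2) (hx : ‖x‖ = 1) :
    ∃ t, |t| ≤ Real.pi ∧ x = circ (s + t) := by
  have hum : inner ℝ (circ s) (circ (s + Real.pi / 2)) = (0:ℝ) := by
    rw [circ_inner]; simp
  have hsq : inner ℝ (circ s) x ^ 2 + inner ℝ (circ (s + Real.pi / 2)) x ^ 2 = (1:ℝ) := by
    have h := real_inner_self_eq_norm_sq x
    rw [hx] at h
    nth_rewrite 1 [circ_expand s x] at h
    rw [inner_add_left, real_inner_smul_left, real_inner_smul_left] at h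
    linarith
  set p : ℝ := inner ℝ (circ s) x with hp
  set q : ℝ := inner ℝ (circ (s + Real.pi / 2)) x with hq
  have hz : ‖(⟨p, q⟩ : ℂ)‖ = 1 := by
    rw [Complex.norm_def, Complex.normSq_mk, ← sq, ← sq, hsq, Real.sqrt_one]
  have hz0 : (⟨p, q⟩ : ℂ) ≠ 0 := by
    intro h; rw [h] at hz; simp at hz
  refine ⟨Complex.arg ⟨p, q⟩, Complex.abs_arg_le_pi _, ?_⟩
  rw [circ_add, Complex.cos_arg hz0, Complex.sin_arg, hz, div_one, div_one]
  exact circ_expand s x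

lemma cone_iff (s α ψ : ℝ) (hα : 0 < α) (hα' : α < Real.pi) (hψ : |ψ| ≤ Real.pi) :
    (Real.cos α / Real.sin α * |inner ℝ (circ (s + Real.pi / 2)) (circ (s + ψ))| ≤
      inner ℝ (circ s) (circ (s + ψ)) ↔ |ψ| ≤ α) := by
  have hs := Real.sin_pos_of_pos_of_lt_pi hα hα'
  have h1 : s + Real.pi / 2 - (s + ψ) = Real.pi / 2 - ψ := by ring
  have h2 : s - (s + ψ) = - ψ := by ring
  rw [circ_inner, circ_inner, h1, h2, Real.cos_pi_div_two_sub, Real.cos_neg]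
  have h3 : |Real.sin ψ| = Real.sin |ψ| := by
    rcases abs_cases ψ with ⟨h, h'⟩ | ⟨h, h'⟩
    · rw [h] at hψ ⊢
      exact abs_of_nonneg (Real.sin_nonneg_of_nonneg_of_le_pi h' hψ)
    · rw [h] at hψ ⊢
      rw [← abs_neg, ← Real.sin_neg]
      exact abs_of_nonneg (Real.sin_nonneg_of_nonneg_of_le_pi (by linarith) hψ)
  have h4 : Real.cos ψ = Real.cos |ψ| := (Real.cos_abs ψ).symm
  have h5 : Real.sin α * (Real.cos ψ - Real.cos α / Real.sin α * |Real.sin ψ|) =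
      Real.sin (α - |ψ|) := by
    rw [Real.sin_sub, h3, h4]; field_simp
  have h6 := abs_nonneg ψ
  rw [← sub_nonneg]
  constructor
  · intro h
    have h7 : 0 ≤ Real.sin (α - |ψ|) := by rw [← h5]; positivity
    by_contra h8
    push Not at h8
    have := Real.sin_neg_of_neg_of_neg_pi_lt (x := α - |ψ|) (by linarith) (by linarith)
    linarith
  · intro h
    have h7 : 0 ≤ Real.sin (α - |ψ|) :=
      Real.sin_nonneg_of_nonneg_of_le_pi (by linarith) (by linarith)
    rw [← h5] at h7
    exact nonneg_of_mul_nonneg_right h7 hs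

lemma phi_norm (x : Euc2) : ‖(max 1 ‖x‖)⁻¹ • x‖ ≤ 1 := by
  rw [norm_smul, norm_inv, Real.norm_eq_abs, abs_of_pos (by positivity), inv_mul_le_one₀ (by positivity)]
  exact le_max_right _ _

lemma phi_lip : LipschitzWith 2 (fun x : Euc2 => (max 1 ‖x‖)⁻¹ • x) := by
  refine LipschitzWith.of_dist_le_mul fun x y => ?_
  have hx : 0 < max 1 ‖x‖ := by positivity
  have hx1 : 1 ≤ max 1 ‖x‖ := le_max_left _ _
  have h1 : (max 1 ‖x‖)⁻¹ • x - (max 1 ‖y‖)⁻¹ • y =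
      (max 1 ‖x‖)⁻¹ • ((x - y) + (max 1 ‖y‖ - max 1 ‖x‖) • ((max 1 ‖y‖)⁻¹ • y)) := by
    have : (max 1 ‖y‖) • ((max 1 ‖y‖)⁻¹ • y) = y := smul_inv_smul₀ (by positivity) y
    rw [sub_smul, this]
    simp only [smul_add, smul_sub]
    rw [inv_smul_smul₀ hx.ne']; abel
  have h2 : |max 1 ‖y‖ - max 1 ‖x‖| ≤ ‖x - y‖ := by
    rw [max_comm 1 ‖y‖, max_comm 1 ‖x‖]
    refine (abs_max_sub_max_le_abs _ _ _).trans ?_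
    rw [norm_sub_rev x y]
    exact abs_norm_sub_norm_le _ _
  have h3 := phi_norm y
  rw [dist_eq_norm, dist_eq_norm]
  rw [h1, norm_smul, norm_inv, Real.norm_eq_abs, abs_of_pos hx]
  have h4 := norm_add_le (x - y) ((max 1 ‖y‖ - max 1 ‖x‖) • ((max 1 ‖y‖)⁻¹ • y))
  rw [norm_smul _ ((max 1 ‖y‖)⁻¹ • y), Real.norm_eq_abs] at h4
  have h5 : |max 1 ‖y‖ - max 1 ‖x‖| * ‖(max 1 ‖y‖)⁻¹ • y‖ ≤ ‖x - y‖ * 1 :=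
    mul_le_mul h2 h3 (norm_nonneg _) (norm_nonneg _)
  have h6 : (max 1 ‖x‖)⁻¹ ≤ 1 := inv_le_one_of_one_le₀ hx1
  push_cast
  calc _ ≤ 1 * ‖(x - y) + (max 1 ‖y‖ - max 1 ‖x‖) • ((max 1 ‖y‖)⁻¹ • y)‖ := by gcongr
    _ ≤ _ := by linarith

lemma lip_bv (γ : ℝ → Euc2) (K : NNReal) (h : LipschitzOnWith K γ (Icc 0 1)) :
    BoundedVariationOn γ (Icc 0 1) := by
  have := h.comp_locallyBoundedVariationOn (f := γ) (g := id) (s := Icc (0:ℝ) 1) (fun x hx => hx)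
    (monotoneOn_id.locallyBoundedVariationOn)
  have h2 := this 0 1 (by simp) (by simp)
  simpa using h2

lemma seg_frontier (E : Set Euc2) (p q : Euc2) (hp : p ∈ closure E) (hq : q ∉ E) :
    ∃ y ∈ segment ℝ p q, y ∈ frontier E := by
  by_contra hcon
  push Not at hcon
  have hpre : IsPreconnected (segment ℝ p q) := (convex_segment p q).isPreconnected
  have hp' : p ∈ interior E := by
    by_contra h
    exact hcon p (left_mem_segment ℝ p q) ⟨hp, h⟩
  have hq' : q ∈ (closure E)ᶜ := by
    intro h
    exact hcon q (right_mem_segment ℝ p q) ⟨h, fun h' => hq (interior_subset h')⟩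
  obtain ⟨z, hz, hz1, hz2⟩ := hpre (interior E) (closure E)ᶜ isOpen_interior isClosed_closure.isOpen_compl
    (fun z hz => by
      by_cases h1 : z ∈ interior E
      · exact Or.inl h1
      · exact Or.inr fun h2 => hcon z hz ⟨h2, h1⟩)
    ⟨p, left_mem_segment ℝ p q, hp'⟩ ⟨q, right_mem_segment ℝ p q, hq'⟩
  exact hz2 (subset_closure (interior_subset hz1))

lemma F_restrict (E : Set Euc2) :
    (volume : Measure Euc2).restrict E = volume.restrict (toMeasurable volume E ∩ closure E) := by
  have h1 : (volume : Measure Euc2).restrict (toMeasurable volume E) = volume.restrict E := by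
    exact Measure.restrict_toMeasurable_of_sFinite E
  rw [← h1]
  apply Measure.restrict_congr_set
  have h2 : volume (toMeasurable volume E ∩ (closure E)ᶜ) = 0 := by
    rw [Measure.measure_toMeasurable_inter_of_sFinite isClosed_closure.measurableSet.compl]
    convert measure_empty (μ := (volume : Measure Euc2))
    ext x
    simp only [mem_inter_iff, mem_compl_iff, mem_empty_iff_false, iff_false, not_and, not_not]
    exact fun h => subset_closure h
  have h3 : ∀ᵐ x ∂(volume : Measure Euc2), x ∉ toMeasurable volume E ∩ (closure E)ᶜ :=
    measure_eq_zero_iff_ae_notMem.1 h2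
  filter_upwards [h3] with x hx
  apply propext
  constructor
  · intro h
    exact ⟨h, by_contra fun h' => hx ⟨h, h'⟩⟩
  · exact fun h => h.1
/-- If `E ⊂ ℝ²` is a set of locally finite perimeter which is a cone outside the unit ball
and whose trace on the unit circle is a single proper closed arc with endpoints `a` and `b`,
then there is a rectifiable curve contained in the topological boundary `∂E` joining `a` to
`b`. -/
theorem exists_rectifiable_curve_in_boundary
    (E : Set Euc2) (hE : HasLocallyFinitePerimeter E)
    (hcone : ∀ x : Euc2, 1 < ‖x‖ → (x ∈ E ↔ ‖x‖⁻¹ • x ∈ E))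
    (a b : Euc2) (θ₁ θ₂ : ℝ) (hθ : θ₁ < θ₂) (hθ' : θ₂ < θ₁ + 2 * Real.pi)
    (harc : E ∩ sphere (0 : Euc2) 1 = circ '' Icc θ₁ θ₂)
    (ha : a = circ θ₁) (hb : b = circ θ₂) :
    ∃ γ : ℝ → Euc2, ContinuousOn γ (Icc 0 1) ∧ BoundedVariationOn γ (Icc 0 1) ∧
      γ 0 = a ∧ γ 1 = b ∧ γ '' Icc 0 1 ⊆ frontier E := by
  set mid : ℝ := (θ₁ + θ₂) / 2 with hmid
  set α : ℝ := (θ₂ - θ₁) / 2 with hα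
  have hα0 : 0 < α := by linarith
  have hαπ : α < Real.pi := by linarith
  have hsin : 0 < Real.sin α := Real.sin_pos_of_pos_of_lt_pi hα0 hαπ
  set c : ℝ := Real.cos α / Real.sin α with hc
  have hcs : c * Real.sin α = Real.cos α := by rw [hc]; field_simp
  set m : Euc2 := circ mid with hm
  set u : Euc2 := circ (mid + Real.pi / 2) with hu
  have hmn : ‖m‖ = 1 := circ_norm _
  have hun : ‖u‖ = 1 := circ_norm _
  have hum : inner ℝ u m = (0:ℝ) := by
    rw [hu, hm, circ_inner]; simp
  have ha2 : a = circ (mid + -α) := by rw [ha]; congr 1; rw [hmid, hα]; ring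
  have hb2 : b = circ (mid + α) := by rw [hb]; congr 1; rw [hmid, hα]; ring
  have haX : a = Real.cos α • m - Real.sin α • u := by
    rw [ha2, circ_add, Real.cos_neg, Real.sin_neg, neg_smul, sub_eq_add_neg]
  have hbX : b = Real.cos α • m + Real.sin α • u := by rw [hb2, circ_add]
  have han : ‖a‖ = 1 := by rw [ha]; exact circ_norm _
  have hbn : ‖b‖ = 1 := by rw [hb]; exact circ_norm _
  have hEs : ∀ x : Euc2, ‖x‖ = 1 → (x ∈ E ↔ c * |inner ℝ u x| ≤ inner ℝ m x) := by
    intro x hx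
    have h1 : x ∈ E ↔ x ∈ circ '' Icc θ₁ θ₂ := by
      rw [← harc]
      exact ⟨fun h => ⟨h, by simpa using hx⟩, fun h => h.1⟩
    rw [h1]
    constructor
    · rintro ⟨φ, hφ, rfl⟩
      have h2 : |φ - mid| ≤ α := by
        rw [abs_le]; constructor <;> linarith [hφ.1, hφ.2]
      have h3 := (cone_iff mid α (φ - mid) hα0 hαπ (by linarith)).2 h2
      rw [add_sub_cancel] at h3
      exact h3
    · intro h
      obtain ⟨ψ, hψ, rfl⟩ := circ_sphere mid x hx
      have h3 := (cone_iff mid α ψ hα0 hαπ hψ).1 h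
      rw [abs_le] at h3
      exact ⟨mid + ψ, ⟨by linarith [h3.1], by linarith [h3.2]⟩, rfl⟩
  have hEout : ∀ x : Euc2, 1 < ‖x‖ → (x ∈ E ↔ c * |inner ℝ u x| ≤ inner ℝ m x) := by
    intro x hx
    have hx0 : 0 < ‖x‖ := by linarith
    have hxi : 0 < ‖x‖⁻¹ := by positivity
    rw [hcone x hx, hEs _ (by rw [norm_smul, norm_inv, norm_norm]; field_simp),
      real_inner_smul_right, real_inner_smul_right, abs_mul, abs_of_pos hxi]
    rw [← mul_le_mul_iff_right₀ hxi (b := c * |inner ℝ u x|)]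
    ring_nf
  have hUo : IsOpen {x : Euc2 | 1 < ‖x‖} := isOpen_lt continuous_const continuous_norm
  have hclE : ∀ x ∈ closure E, 1 < ‖x‖ → x ∈ E := by
    intro x hx hx1
    rw [hEout x hx1]
    have hcl : IsClosed {x : Euc2 | c * |inner ℝ u x| ≤ inner ℝ m x} :=
      isClosed_le (by fun_prop) (by fun_prop)
    have h2 : x ∈ closure ({x : Euc2 | 1 < ‖x‖} ∩ E) := hUo.inter_closure ⟨hx1, hx⟩
    exact hcl.closure_subset_iff.2 (fun y hy => (hEout y hy.1).1 hy.2) h2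
  have hfr : ∀ x ∈ frontier E, 1 < ‖x‖ → inner ℝ m x = c * |inner ℝ u x| := by
    intro x hx hx1
    refine le_antisymm ?_ ((hEout x hx1).1 (hclE x hx.1 hx1))
    by_contra h
    push Not at h
    apply hx.2
    rw [mem_interior]
    refine ⟨{x : Euc2 | 1 < ‖x‖} ∩ {x : Euc2 | c * |inner ℝ u x| < inner ℝ m x},
      fun y hy => (hEout y hy.1).2 (le_of_lt hy.2),
      hUo.inter (isOpen_lt (by fun_prop) (by fun_prop)), hx1, h⟩
  have hray : ∀ x : Euc2, 0 < ‖x‖ → inner ℝ m x = c * |inner ℝ u x| →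
      (inner ℝ u x < 0 ∧ ‖x‖⁻¹ • x = a) ∨ (0 < inner ℝ u x ∧ ‖x‖⁻¹ • x = b) := by
    intro x hx0 hx
    have hexp : x = inner ℝ m x • m + inner ℝ u x • u := circ_expand mid x
    have hscale : ∀ (r : ℝ) (v : Euc2), 0 < r → ‖v‖ = 1 → x = r • v → ‖x‖⁻¹ • x = v := by
      intro r v hr hv hxr
      have : ‖x‖ = r := by rw [hxr, norm_smul, hv, Real.norm_eq_abs, abs_of_pos hr, mul_one]
      rw [this, hxr, inv_smul_smul₀ hr.ne']
    rw [hx] at hexp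
    set s : ℝ := inner ℝ u x with hs
    rcases lt_trichotomy s 0 with h | h | h
    · left
      refine ⟨h, hscale (-s / Real.sin α) a (div_pos (by linarith) hsin) han ?_⟩
      rw [haX, hexp, smul_sub, smul_smul, smul_smul, div_mul_cancel₀ _ hsin.ne', neg_smul,
        sub_neg_eq_add, abs_of_neg h]
      congr 2
      rw [hc]; ring
    · exfalso
      rw [h] at hexp
      simp only [abs_zero, mul_zero, zero_smul, add_zero] at hexp
      rw [hexp] at hx0
      simp at hx0
    · right
      refine ⟨h, hscale (s / Real.sin α) b (div_pos h hsin) hbn ?_⟩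
      rw [hbX, hexp, smul_add, smul_smul, smul_smul, div_mul_cancel₀ _ hsin.ne', abs_of_pos h]
      congr 2
      rw [hc]; ring
  have hmm : inner ℝ m m = (1:ℝ) := by rw [real_inner_self_eq_norm_sq, hmn]; norm_num
  have huu : inner ℝ u u = (1:ℝ) := by rw [real_inner_self_eq_norm_sq, hun]; norm_num
  have hmu : inner ℝ m u = (0:ℝ) := by rw [real_inner_comm]; exact hum
  have hpt : ∀ v : Euc2, ‖v‖ = 1 → inner ℝ m v = c * |inner ℝ u v| → v ∈ frontier E := by
    intro v hv hv2
    refine ⟨subset_closure ((hEs v hv).2 hv2.ge), fun hint => ?_⟩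
    have hcont : Continuous fun δ : ℝ => (1 + δ) • v - (δ / 2) • m := by fun_prop
    have h1 : ∀ᶠ δ in 𝓝 (0:ℝ), (1 + δ) • v - (δ / 2) • m ∈ interior E :=
      hcont.continuousAt.eventually_mem (isOpen_interior.mem_nhds (by simpa using hint))
    have h2 : ∀ᶠ δ in 𝓝[>] (0:ℝ), (1 + δ) • v - (δ / 2) • m ∈ interior E :=
      h1.filter_mono nhdsWithin_le_nhds
    obtain ⟨δ, hδ, hδ0⟩ := (h2.and self_mem_nhdsWithin).exists
    have hδ1 : 0 < δ := hδ0
    have hnorm : 1 < ‖(1 + δ) • v - (δ / 2) • m‖ := by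
      have := norm_sub_norm_le ((1 + δ) • v) ((δ / 2) • m)
      rw [norm_smul, norm_smul, hv, hmn, Real.norm_eq_abs, Real.norm_eq_abs,
        abs_of_pos (by linarith : 0 < 1 + δ), abs_of_pos (by linarith : 0 < δ / 2)] at this
      linarith
    have h3 := (hEout _ hnorm).1 (interior_subset hδ)
    simp only [inner_sub_right, real_inner_smul_right, hum, hmm, hv2, abs_mul, mul_zero,
      sub_zero, mul_one, abs_of_pos (by linarith : 0 < 1 + δ)] at h3
    linarith
  have hafr : a ∈ frontier E := by
    apply hpt a han
    rw [haX]
    simp only [inner_sub_right, real_inner_smul_right, hum, hmm, hmu, huu, mul_zero, mul_one,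
      zero_sub, sub_zero, abs_neg, abs_of_pos hsin, hcs]
  have hbfr : b ∈ frontier E := by
    apply hpt b hbn
    rw [hbX]
    simp only [inner_add_right, real_inner_smul_right, hum, hmm, hmu, huu, mul_zero, mul_one,
      zero_add, add_zero, abs_of_pos hsin, hcs]
  -- the measurable representative
  set F : Set Euc2 := toMeasurable volume E ∩ closure E with hFdef
  have hFm : MeasurableSet F :=
    (measurableSet_toMeasurable _ _).inter isClosed_closure.measurableSet
  have hEF : E ⊆ F := fun x hx => ⟨subset_toMeasurable _ _ hx, subset_closure hx⟩
  have hFout : ∀ x : Euc2, 1 < ‖x‖ → (x ∈ F ↔ c * |inner ℝ u x| ≤ inner ℝ m x) := by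
    intro x hx
    rw [← hEout x hx]
    exact ⟨fun h => hclE x h.2 hx, fun h => hEF h⟩
  obtain ⟨C, R₀, hC0, hch⟩ := chain_exists E F u m hun hmn hum c hFm
    (fun p hp q hq => seg_frontier E p q hp.2 fun h => hq (hEF h)) hFout
    (diff_est E F hE hFm (F_restrict E))
  choose k x hx hstep hlen h0 h1 using hch
  have hlim : Tendsto (fun n : ℕ => 1 / ((n:ℝ) + 1)) atTop (𝓝 0) :=
    tendsto_one_div_add_atTop_nhds_zero_nat
  obtain ⟨γ, l, hl, hlip, hγK, hγ0, hγ1⟩ := limit_curve (frontier E ∩ closedBall 0 R₀)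
    ((isCompact_closedBall 0 R₀).inter_left isClosed_frontier) C hC0 k x hx
    (fun n => 5 * (1 / ((n:ℝ) + 1))) (by simpa using hlim.const_mul 5) hstep hlen
  have hlim4 : Tendsto (fun n : ℕ => 4 * (1 / ((n:ℝ) + 1))) l (𝓝 0) := by
    have := (hlim.const_mul 4).mono_left hl
    simpa using this
  have e0 : inner ℝ u (γ 0) = (-2:ℝ) := by
    have t1 : Tendsto (fun n => |inner ℝ u (x n 0) + 2|) l (𝓝 |inner ℝ u (γ 0) + 2|) :=
      ((tendsto_const_nhds.inner hγ0).add_const 2).abs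
    have := le_of_tendsto_of_tendsto' t1 hlim4 h0
    have := abs_eq_zero.1 (le_antisymm this (abs_nonneg _))
    linarith
  have e1 : inner ℝ u (γ 1) = (2:ℝ) := by
    have t1 : Tendsto (fun n => |inner ℝ u (x n (k n)) - 2|) l (𝓝 |inner ℝ u (γ 1) - 2|) :=
      ((tendsto_const_nhds.inner hγ1).sub_const 2).abs
    have := le_of_tendsto_of_tendsto' t1 hlim4 h1
    have := abs_eq_zero.1 (le_antisymm this (abs_nonneg _))
    linarith
  have n0 : 1 < ‖γ 0‖ := by
    have := abs_real_inner_le_norm u (γ 0)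
    rw [e0, hun] at this
    norm_num at this
    linarith
  have n1 : 1 < ‖γ 1‖ := by
    have := abs_real_inner_le_norm u (γ 1)
    rw [e1, hun] at this
    norm_num at this
    linarith
  have hlip2 : LipschitzOnWith (2 * C.toNNReal) (fun t => (max 1 ‖γ t‖)⁻¹ • γ t) (Icc 0 1) :=
    phi_lip.comp_lipschitzOnWith hlip
  refine ⟨fun t => (max 1 ‖γ t‖)⁻¹ • γ t, hlip2.continuousOn, lip_bv _ _ hlip2, ?_, ?_, ?_⟩
  · show (max 1 ‖γ 0‖)⁻¹ • γ 0 = a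
    rw [max_eq_right n0.le]
    rcases hray (γ 0) (by linarith) (hfr _ (hγK 0).1 n0) with h | h
    · exact h.2
    · rw [e0] at h; exact absurd h.1 (by norm_num)
  · show (max 1 ‖γ 1‖)⁻¹ • γ 1 = b
    rw [max_eq_right n1.le]
    rcases hray (γ 1) (by linarith) (hfr _ (hγK 1).1 n1) with h | h
    · rw [e1] at h; exact absurd h.1 (by norm_num)
    · exact h.2
  · rintro _ ⟨t, ht, rfl⟩
    show (max 1 ‖γ t‖)⁻¹ • γ t ∈ frontier E
    by_cases hn : 1 < ‖γ t‖
    · rw [max_eq_right hn.le]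
      rcases hray (γ t) (by linarith) (hfr _ (hγK t).1 hn) with h | h
      · rw [h.2]; exact hafr
      · rw [h.2]; exact hbfr
    · rw [max_eq_left (not_lt.1 hn), inv_one, one_smul]
      exact (hγK t).1
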